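/- (Shifted Fenchel–Young inequality.) For all α, β > 0, all A ≥ 0, and all v, w ∈ ℝ: ψ_{α,β}(v) + ψ*_{α,β}(w) ≥ max(|w|, A)·|v| − ψ*_{α,β}(A). -/

import Mathlib

open Real Filter Topology Set

/-- `ψ_{α,β}(v)`, the dissipation potential from Kramers' rates. -/
noncomputable def psi (a b v : ℝ) : ℝ :=
  v / b * Real.log ((v + Real.sqrt (v ^ 2 + 4 * a ^ 2)) / (2 * a))
    - 1 / b * Real.sqrt (v ^ 2 + 4 * a ^ 2) + 2 * a / b

/-- `ψ*_{α,β}(w)`, the dual dissipation potential. -/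
noncomputable def psiStar (a b w : ℝ) : ℝ :=
  2 * a / b * (Real.cosh (b * w) - 1)

/-- The graph of `cosh` lies above its tangent lines. -/
lemma cosh_add_mul_sinh_le_cosh (u x : ℝ) :
    Real.cosh u + (x - u) * Real.sinh u ≤ Real.cosh x := by
  have h₁ : Real.exp u * (x - u + 1) ≤ Real.exp x := by
    calc Real.exp u * (x - u + 1) ≤ Real.exp u * Real.exp (x - u) := by
          gcongr
          exact Real.add_one_le_exp _
      _ = Real.exp x := by rw [← Real.exp_add]; ring_nf
  have h₂ : Real.exp (-u) * (u - x + 1) ≤ Real.exp (-x) := by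
    calc Real.exp (-u) * (u - x + 1) ≤ Real.exp (-u) * Real.exp (u - x) := by
          gcongr
          exact Real.add_one_le_exp _
      _ = Real.exp (-x) := by rw [← Real.exp_add]; ring_nf
  rw [Real.cosh_eq, Real.cosh_eq, Real.sinh_eq]
  linarith

lemma psi_two_mul_sinh {a : ℝ} (b u : ℝ) (ha : 0 < a) :
    psi a b (2 * a * Real.sinh u) =
      2 * a / b * (u * Real.sinh u - Real.cosh u + 1) := by
  have hsqrt : Real.sqrt ((2 * a * Real.sinh u) ^ 2 + 4 * a ^ 2) = 2 * a * Real.cosh u := by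
    rw [show (2 * a * Real.sinh u) ^ 2 + 4 * a ^ 2 = (2 * a * Real.cosh u) ^ 2 by
      rw [mul_pow, mul_pow _ (Real.cosh u), Real.cosh_sq]; ring]
    exact Real.sqrt_sq (mul_nonneg (by positivity) (Real.cosh_pos u).le)
  have hexp : (2 * a * Real.sinh u + 2 * a * Real.cosh u) / (2 * a) = Real.exp u := by
    rw [← mul_add, Real.sinh_add_cosh, mul_div_cancel_left₀ _ (by positivity)]
  rw [psi, hsqrt, hexp, Real.log_exp]
  ring

/-- The Fenchel–Young inequality for the pair `ψ`, `ψ*`. -/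
lemma mul_le_psi_add_psiStar {a b : ℝ} (ha : 0 < a) (hb : 0 < b) (v w : ℝ) :
    w * v ≤ psi a b v + psiStar a b w := by
  obtain ⟨u, rfl⟩ : ∃ u, v = 2 * a * Real.sinh u :=
    ⟨Real.arsinh (v / (2 * a)), by rw [Real.sinh_arsinh]; field_simp⟩
  rw [psi_two_mul_sinh b u ha, psiStar]
  calc w * (2 * a * Real.sinh u) = 2 * a / b * (b * w * Real.sinh u) := by field_simp
    _ ≤ 2 * a / b * (u * Real.sinh u - Real.cosh u + 1 + (Real.cosh (b * w) - 1)) := by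
        gcongr
        linarith [cosh_add_mul_sinh_le_cosh u (b * w)]
    _ = _ := by ring

lemma psiStar_neg (a b w : ℝ) : psiStar a b (-w) = psiStar a b w := by
  rw [psiStar, psiStar, mul_neg, Real.cosh_neg]

lemma psiStar_nonneg {a b : ℝ} (ha : 0 < a) (hb : 0 < b) (w : ℝ) : 0 ≤ psiStar a b w :=
  mul_nonneg (by positivity) (sub_nonneg.2 (Real.one_le_cosh _))

lemma abs_mul_abs_le_psi_add_psiStar {a b : ℝ} (ha : 0 < a) (hb : 0 < b) (v w : ℝ) :
    |w| * |v| ≤ psi a b v + psiStar a b w := by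
  rw [← abs_mul, abs_le']
  refine ⟨mul_le_psi_add_psiStar ha hb v w, ?_⟩
  simpa only [neg_mul, psiStar_neg] using mul_le_psi_add_psiStar ha hb v (-w)

/-- shifted Fenchel–Young inequality: for all `α, β > 0`, `A ≥ 0` and all
`v, w ∈ ℝ`, `ψ_{α,β}(v) + ψ*_{α,β}(w) ≥ max(|w|, A)·|v| − ψ*_{α,β}(A)`. -/
theorem shifted_fenchel_young
    (a b A v w : ℝ) (ha : 0 < a) (hb : 0 < b) (hA : 0 ≤ A) :
    max |w| A * |v| - psiStar a b A ≤ psi a b v + psiStar a b w := by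
  rcases max_cases |w| A with ⟨h, -⟩ | ⟨h, -⟩ <;> rw [h]
  · linarith [abs_mul_abs_le_psi_add_psiStar ha hb v w, psiStar_nonneg ha hb A]
  · have hvA := abs_mul_abs_le_psi_add_psiStar ha hb v A
    rw [abs_of_nonneg hA] at hvA
    linarith [psiStar_nonneg ha hb w]
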